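/- Every d-dimensional latin hypercube Q of order n has at most n^(3d−1) cuboctahedra in total. -/

import Mathlib

/-- A `d`-dimensional latin hypercube of order `n`: in each line (each coordinate varies,
the others are fixed) all symbols are distinct. -/
def IsLatinHypercube {d n : ℕ} (Q : (Fin d → Fin n) → Fin n) : Prop :=
  ∀ (i : Fin d) (x : Fin d → Fin n),
    Function.Bijective (fun v : Fin n => Q (Function.update x i v))

/-- `(A, B)` is a cuboctahedron of the hypercube `Q`: the two (possibly degenerate)
subcubes of order 2 determined by the pairs `A i` and `B i` carry the same symbols. -/
def IsCuboct {d n : ℕ} (Q : (Fin d → Fin n) → Fin n)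
    (A B : Fin d → Fin n × Fin n) : Prop :=
  ∀ j : Fin d → Fin 2,
    Q (fun i => if j i = 0 then (A i).1 else (A i).2) =
    Q (fun i => if j i = 0 then (B i).1 else (B i).2)

/-- The number of cuboctahedra of the hypercube `Q` (ordered pairs `(A, B)`). -/
noncomputable def cuboctCount {d n : ℕ} (Q : (Fin d → Fin n) → Fin n) : ℕ :=
  Set.ncard {p : (Fin d → Fin n × Fin n) × (Fin d → Fin n × Fin n) |
    IsCuboct Q p.1 p.2}

/-- A `d`-dimensional latin hypercube of order `n` has at most `n ^ (3d - 1)`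
cuboctahedra in total. -/
theorem cuboctCount_le {d n : ℕ}
    (Q : (Fin d → Fin n) → Fin n) (hQ : IsLatinHypercube Q) :
    cuboctCount Q ≤ n ^ (3 * d - 1) := by
  classical
  have key : ∀ (A : Fin d → Fin n × Fin n) (i : Fin d),
      (fun k => if (if k = i then (1 : Fin 2) else 0) = 0 then (A k).1 else (A k).2)
        = Function.update (fun k => (A k).1) i (A i).2 := by
    intro A i
    funext k
    by_cases h : k = i
    · subst h; simp
    · simp [h]
  rcases d with _ | m
  · unfold cuboctCount
    refine (Set.ncard_le_one_of_subsingleton _).trans ?_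
    simp
  · unfold cuboctCount
    let f : (Fin (m + 1) → Fin n × Fin n) × (Fin (m + 1) → Fin n × Fin n) →
        (Fin (m + 1) → Fin n × Fin n) × (Fin m → Fin n) :=
      fun p => (p.1, fun i => (p.2 i.succ).1)
    have hinj : Set.InjOn f {p | IsCuboct Q p.1 p.2} := by
      rintro ⟨A, B⟩ h ⟨A', B'⟩ h' hf
      simp only [Set.mem_ofPred_eq] at h h'
      simp only [f, Prod.mk.injEq] at hf
      obtain ⟨rfl, hB⟩ := hf
      have h1 : (fun k => (B k).1) = fun k => (B' k).1 := by
        have e : (fun k => (B' k).1) = Function.update (fun k => (B k).1) 0 (B' 0).1 := by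
          funext k
          refine Fin.cases ?_ (fun l => ?_) k
          · simp
          · simpa using (congrFun hB l).symm
        have e0 : (fun k => (B k).1) = Function.update (fun k => (B k).1) 0 (B 0).1 := by
          simp
        have q := (h (fun _ => 0)).symm.trans (h' (fun _ => 0))
        simp only [if_true] at q
        rw [e, e0] at q
        simp only [Function.update_idem] at q
        have := (hQ 0 (fun k => (B k).1)).1 q
        try simp only [Function.update_self] at this
        rw [e, ← this]
        simp
      have h2 : ∀ i, (B i).2 = (B' i).2 := by
        intro i
        have q := (h (fun k => if k = i then 1 else 0)).symm.trans
          (h' (fun k => if k = i then 1 else 0))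
        rw [key, key, ← h1] at q
        exact (hQ i (fun k => (B k).1)).1 q
      have : B = B' := by
        funext i
        exact Prod.ext (congrFun h1 i) (h2 i)
      rw [this]
    rw [← Set.ncard_image_of_injOn hinj]
    refine (Set.ncard_le_card _).trans ?_
    simp only [Nat.card_eq_fintype_card, Fintype.card_prod, Fintype.card_fun, Fintype.card_fin]
    apply le_of_eq
    rw [← pow_two, ← pow_mul, ← pow_add]
    congr 1
    omega
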